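/- Let n ≥ 2, 0 < p, q ≤ ∞ and s ∈ ℝ. There exists a constant C > 0 such that for every Schwartz function f ∈ 𝒮(ℝⁿ), ‖Tr f‖_{M^s_{p,q}(ℝ^{n−1})} ≤ C ‖f‖_{M^s_{p,q,min(p,q,1)}(ℝⁿ)}. -/

import Mathlib

open MeasureTheory FourierTransform
open scoped ENNReal NNReal

noncomputable section

/-- `η` is an admissible bump function: smooth, valued in `[0,1]`, equal to `1` on `|t| ≤ 1`
and vanishing for `|t| ≥ 2`. -/
def IsBump (η : ℝ → ℝ) : Prop :=
  ContDiff ℝ (⊤ : ℕ∞) η ∧ (∀ t, η t ∈ Set.Icc (0:ℝ) 1) ∧ (∀ t, |t| ≤ 1 → η t = 1) ∧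
    (∀ t, 2 ≤ |t| → η t = 0)

/-- Japanese bracket `⟨k⟩ = (1+|k|²)^{1/2}` of an integer vector. -/
def jbr {d : ℕ} (k : Fin d → ℤ) : ℝ := (1 + ∑ i, ((k i : ℝ))^2) ^ ((1:ℝ)/2)

/-- `ψ_k`, the normalized window at frequency `k ∈ ℤ^d`. -/
def unifWindow (η : ℝ → ℝ) {d : ℕ} (k : Fin d → ℤ) (ξ : EuclideanSpace ℝ (Fin d)) : ℝ :=
  (∏ i, η (2 * (ξ i - k i))) / ∑' l : Fin d → ℤ, ∏ i, η (2 * (ξ i - l i))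

/-- The frequency-uniform decomposition operator `□_k f = 𝓕⁻¹(ψ_k 𝓕 f)`. -/
def unifBox (η : ℝ → ℝ) {d : ℕ} (k : Fin d → ℤ) (f : EuclideanSpace ℝ (Fin d) → ℂ) :
    EuclideanSpace ℝ (Fin d) → ℂ :=
  𝓕⁻ (fun ξ => (unifWindow η k ξ : ℂ) * 𝓕 f ξ)

/-- The `ℓ^q` combination of a family of extended nonnegative reals, with the supremum
modification for `q = ∞`. -/
def lqSum {ι : Type*} (q : ℝ≥0∞) (a : ι → ℝ≥0∞) : ℝ≥0∞ :=
  if q = ∞ then ⨆ i, a i else (∑' i, a i ^ q.toReal) ^ (1 / q.toReal)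

/-- The modulation space quasi-norm `‖f‖_{M^s_{p,q}(ℝ^d)}`. -/
def modNorm (η : ℝ → ℝ) {d : ℕ} (s : ℝ) (p q : ℝ≥0∞) (f : EuclideanSpace ℝ (Fin d) → ℂ) :
    ℝ≥0∞ :=
  lqSum q (fun k : Fin d → ℤ =>
    ENNReal.ofReal (jbr k ^ s) * eLpNorm (unifBox η k f) p volume)

/-- The anisotropic modulation space quasi-norm `‖f‖_{M^s_{p,q,r}(ℝ^{m+1})}`. -/
def modNormAniso (η : ℝ → ℝ) {m : ℕ} (s : ℝ) (p q r : ℝ≥0∞)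
    (f : EuclideanSpace ℝ (Fin (m+1)) → ℂ) : ℝ≥0∞ :=
  lqSum r (fun kn : ℤ => lqSum q (fun kb : Fin m → ℤ =>
    ENNReal.ofReal (jbr kb ^ s) *
      eLpNorm (unifBox η (Fin.snoc kb kn) f) p volume))

/-- The trace `(Tr f)(x̄) = f(x̄, 0)` on the hyperplane `x_n = 0`. -/
def traceFn {m : ℕ} (f : EuclideanSpace ℝ (Fin (m+1)) → ℂ)
    (x : EuclideanSpace ℝ (Fin m)) : ℂ :=
  f ((WithLp.equiv 2 (Fin (m+1) → ℝ)).symm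
      (Fin.snoc ((WithLp.equiv 2 (Fin m → ℝ)) x) 0))


open MeasureTheory FourierTransform
open scoped ENNReal NNReal

noncomputable section

lemma eLpNorm_tsum_le_aux {α ι : Type*} [Countable ι] [MeasurableSpace α] (μ : Measure α)
    {p : ℝ≥0∞} (hp : 1 ≤ p) (g : ι → α → ℝ≥0∞) (hg : ∀ i, Measurable (g i)) :
    eLpNorm (fun x => ∑' i, g i x) p μ ≤ ∑' i, eLpNorm (g i) p μ := by
  have hfin : ∀ s : Finset ι, eLpNorm (fun x => ∑ i ∈ s, g i x) p μ ≤ ∑' i, eLpNorm (g i) p μ := by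
    intro s
    have h1 := eLpNorm_sum_le (μ := μ) (f := g) (s := s) (fun i _ => (hg i).aestronglyMeasurable) hp
    have h2 : (∑ i ∈ s, g i) = fun x => ∑ i ∈ s, g i x := by ext x; simp
    rw [h2] at h1
    exact h1.trans (ENNReal.sum_le_tsum s)
  rcases eq_or_ne p ∞ with rfl | hpt
  · rw [eLpNorm_exponent_top, eLpNormEssSup]
    refine essSup_le_of_ae_le _ ?_
    have : ∀ i, ∀ᵐ x ∂μ, g i x ≤ eLpNorm (g i) ∞ μ := by
      intro i
      rw [eLpNorm_exponent_top]
      simpa using enorm_ae_le_eLpNormEssSup (g i) μ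
    filter_upwards [ae_all_iff.2 this] with x hx
    simpa using ENNReal.tsum_le_tsum hx
  · have hp0 : p ≠ 0 := (zero_lt_one.trans_le hp).ne'
    have hpp : 0 < p.toReal := ENNReal.toReal_pos hp0 hpt
    rw [eLpNorm_eq_lintegral_rpow_enorm_toReal hp0 hpt]
    simp only [enorm_eq_self]
    rw [one_div, ENNReal.rpow_inv_le_iff hpp]
    have h1 : ∀ x, (∑' i, g i x) ^ p.toReal = ⨆ s : Finset ι, (∑ i ∈ s, g i x) ^ p.toReal := by
      intro x
      rw [ENNReal.tsum_eq_iSup_sum]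
      exact (ENNReal.orderIsoRpow p.toReal hpp).map_iSup _
    simp_rw [h1]
    rw [lintegral_iSup_directed]
    · apply iSup_le
      intro s
      have := hfin s
      rw [eLpNorm_eq_lintegral_rpow_enorm_toReal hp0 hpt, one_div,
        ENNReal.rpow_inv_le_iff hpp] at this
      simpa using this
    · intro s
      exact ((Finset.measurable_sum s (fun i _ => hg i)).pow_const _).aemeasurable
    · classical
      apply Monotone.directed_le
      intro s t hst x
      exact ENNReal.rpow_le_rpow (Finset.sum_le_sum_of_subset hst) hpp.le

lemma eLpNorm_rpow_aux {α : Type*} [MeasurableSpace α] (μ : Measure α)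
    {p r : ℝ≥0∞} (hr : 0 < r) (hrt : r ≠ ∞) (g : α → ℝ≥0∞) :
    eLpNorm (fun x => g x ^ r.toReal) (p / r) μ = eLpNorm g p μ ^ r.toReal := by
  have h := eLpNorm_enorm_rpow (μ := μ) (p := p / r) g (ENNReal.toReal_pos hr.ne' hrt)
  rw [ENNReal.ofReal_toReal hrt, ENNReal.div_mul_cancel hr.ne' hrt] at h
  simpa using h

lemma ENNReal.tsum_rpow_le {ι : Type*} {r : ℝ} (hr : 0 < r) (hr1 : r ≤ 1) (g : ι → ℝ≥0∞) :
    (∑' i, g i) ^ r ≤ ∑' i, g i ^ r := by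
  have : (∑' i, g i) ^ r = ⨆ s : Finset ι, (∑ i ∈ s, g i) ^ r := by
    rw [ENNReal.tsum_eq_iSup_sum]
    exact (ENNReal.orderIsoRpow r hr).map_iSup _
  rw [this]
  apply iSup_le
  intro s
  refine le_trans ?_ (ENNReal.sum_le_tsum s)
  classical
  induction s using Finset.induction_on with
  | empty => simp [hr]
  | insert a s ha ih =>
    rw [Finset.sum_insert ha, Finset.sum_insert ha]
    exact (ENNReal.rpow_add_le_add_rpow _ _ hr.le hr1).trans (by gcongr)

lemma eLpNorm_tsum_rpow_le {α ι : Type*} [Countable ι] [MeasurableSpace α] (μ : Measure α)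
    {p r : ℝ≥0∞} (hr : 0 < r) (hr1 : r ≤ 1) (hrp : r ≤ p) (g : ι → α → ℝ≥0∞)
    (hg : ∀ i, Measurable (g i)) :
    eLpNorm (fun x => ∑' i, g i x) p μ ^ r.toReal ≤ ∑' i, eLpNorm (g i) p μ ^ r.toReal := by
  have hrt : r ≠ ∞ := (hr1.trans_lt ENNReal.one_lt_top).ne
  have hr0 : 0 < r.toReal := ENNReal.toReal_pos hr.ne' hrt
  have hr1' : r.toReal ≤ 1 := by
    simpa using ENNReal.toReal_mono ENNReal.one_ne_top hr1
  simp_rw [← eLpNorm_rpow_aux μ hr hrt]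
  refine le_trans ?_ (eLpNorm_tsum_le_aux μ ?_ _ (fun i => (hg i).pow_const _))
  · apply eLpNorm_mono_enorm
    intro x
    simpa using ENNReal.tsum_rpow_le hr0 hr1' _
  · rw [ENNReal.le_div_iff_mul_le (Or.inl hr.ne') (Or.inl hrt), one_mul]; exact hrp

lemma lqSum_eq_eLpNorm {ι : Type*} [MeasurableSpace ι] [MeasurableSingletonClass ι]
    {q : ℝ≥0∞} (hq : 0 < q) (a : ι → ℝ≥0∞) :
    lqSum q a = eLpNorm a q Measure.count := by
  unfold lqSum
  split_ifs with h
  · subst h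
    rw [eLpNorm_exponent_top, eLpNormEssSup, essSup_count]
    simp
  · rw [eLpNorm_eq_lintegral_rpow_enorm_toReal hq.ne' h, lintegral_count]
    simp

/-- Abstract sequence-space estimate. -/
lemma lqSum_bound {m : ℕ} {q r : ℝ≥0∞} (hr : 0 < r) (hr1 : r ≤ 1) (hrq : r ≤ q)
    (J : Finset (Fin m → ℤ)) (C : ℝ≥0∞)
    (a : (Fin m → ℤ) → ℝ≥0∞) (b : ℤ → (Fin m → ℤ) → ℝ≥0∞)
    (h : ∀ k, a k ^ r.toReal ≤ ∑' t : ℤ, ∑ j ∈ J, (C * b t (k + j)) ^ r.toReal) :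
    lqSum q a ≤ ((J.card : ℝ≥0∞) ^ (1 / r.toReal) * C) * lqSum r (fun t => lqSum q (b t)) := by
  have hq : 0 < q := hr.trans_le hrq
  have hrt : r ≠ ∞ := (hr1.trans_lt ENNReal.one_lt_top).ne
  have hr0 : 0 < r.toReal := ENNReal.toReal_pos hr.ne' hrt
  let _ : MeasurableSpace (Fin m → ℤ) := ⊤
  have key : lqSum q a ^ r.toReal ≤ ∑' t : ℤ, ∑ j ∈ J, (C * lqSum q (b t)) ^ r.toReal := by
    rw [lqSum_eq_eLpNorm hq, ← eLpNorm_rpow_aux _ hr hrt]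
    have e1 : ∀ k, (∑' t : ℤ, ∑ j ∈ J, (C * b t (k + j)) ^ r.toReal) =
        ∑' i : ℤ × J, (C * b i.1 (k + i.2)) ^ r.toReal := by
      intro k
      rw [ENNReal.tsum_prod']
      congr 1; ext t
      rw [tsum_fintype, Finset.sum_coe_sort J (fun j => (C * b t (k + j)) ^ r.toReal)]
    refine (eLpNorm_mono_enorm (g := fun k => ∑' i : ℤ × J, (C * b i.1 (k + i.2)) ^ r.toReal)
      (fun k => ?_)).trans ?_
    · simpa [e1] using h k
    refine (eLpNorm_tsum_le_aux _ ?_ _ (fun i => measurable_from_top)).trans ?_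
    · rw [ENNReal.le_div_iff_mul_le (Or.inl hr.ne') (Or.inl hrt), one_mul]; exact hrq
    rw [ENNReal.tsum_prod']
    refine ENNReal.tsum_le_tsum fun t => ?_
    rw [tsum_fintype, ← Finset.sum_coe_sort J]
    refine Finset.sum_le_sum fun j _ => ?_
    dsimp only
    rw [eLpNorm_rpow_aux _ hr hrt (fun k => C * b t (k + j))]
    apply ENNReal.rpow_le_rpow _ hr0.le
    rw [← lqSum_eq_eLpNorm hq]
    unfold lqSum
    split_ifs with hqt
    · rw [ENNReal.mul_iSup]
      exact iSup_le fun k => le_iSup (fun k => C * b t k) (k + j)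
    · have hq0 : 0 < q.toReal := ENNReal.toReal_pos hq.ne' hqt
      simp_rw [ENNReal.mul_rpow_of_nonneg _ _ hq0.le]
      rw [ENNReal.tsum_mul_left, ENNReal.mul_rpow_of_nonneg _ _ (by positivity),
        ← ENNReal.rpow_mul, mul_one_div_cancel hq0.ne', ENNReal.rpow_one]
      refine mul_le_mul' le_rfl (ENNReal.rpow_le_rpow (le_of_eq ?_) (by positivity))
      exact (Equiv.addRight (j : Fin m → ℤ)).tsum_eq (fun k => b t k ^ q.toReal)
  have e2 : (∑' t : ℤ, ∑ j ∈ J, (C * lqSum q (b t)) ^ r.toReal)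
     = (((J.card : ℝ≥0∞) ^ (1 / r.toReal) * C) * lqSum r (fun t => lqSum q (b t))) ^ r.toReal := by
    simp only [Finset.sum_const, nsmul_eq_mul]
    conv_rhs => rw [lqSum, if_neg hrt]
    rw [ENNReal.mul_rpow_of_nonneg _ _ hr0.le, ENNReal.mul_rpow_of_nonneg _ _ hr0.le,
        ← ENNReal.rpow_mul, ← ENNReal.rpow_mul, one_div_mul_cancel hr0.ne', ENNReal.rpow_one,
        ENNReal.rpow_one]
    simp_rw [ENNReal.mul_rpow_of_nonneg _ _ hr0.le]
    rw [ENNReal.tsum_mul_left, ENNReal.tsum_mul_left, mul_assoc]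
  rw [e2] at key
  exact (ENNReal.rpow_le_rpow_iff hr0).1 key
end

open MeasureTheory FourierTransform
open scoped ENNReal NNReal

noncomputable section
section
variable {V : Type*} [NormedAddCommGroup V] [InnerProductSpace ℝ V] [FiniteDimensional ℝ V]
  [MeasurableSpace V] [BorelSpace V]

open scoped RealInnerProductSpace in
lemma fourier_conv_aux (a b : SchwartzMap V ℂ) (x ζ : V) :
    𝓕 (fun y => 𝓕⁻ (a : V → ℂ) y * 𝓕⁻ (b : V → ℂ) (x - y)) ζ =
      ∫ ξ, a ξ * (Real.fourierChar ⟪x, ξ - ζ⟫ • b (ξ - ζ)) := by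
  have hbint : Integrable (𝓕⁻ (b : V → ℂ)) := by
    rw [← SchwartzMap.fourierInv_coe]; exact (𝓕⁻ b).integrable
  have hbx : Integrable (fun y => 𝓕⁻ (b : V → ℂ) (x - y)) := hbint.comp_sub_left x
  set g : V → ℂ := fun y => Real.fourierChar (-⟪y, ζ⟫) • 𝓕⁻ (b : V → ℂ) (x - y) with hg
  have hgint : Integrable g := by
    have := (Real.fourierIntegral_convergent_iff (μ := volume) (f := fun y => 𝓕⁻ (b : V → ℂ) (x - y)) ζ).2 hbx
    exact this
  have h1 := VectorFourier.integral_fourierIntegral_smul_eq_flip (μ := (volume : Measure V))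
    (ν := (volume : Measure V)) (L := -innerₗ V) (f := (a : V → ℂ)) (g := g)
    Real.continuous_fourierChar (by simp only [LinearMap.neg_apply, innerₗ_apply_apply]; fun_prop) a.integrable hgint
  rw [Real.fourier_eq]
  have h2 : ∀ y, Real.fourierChar (-⟪y, ζ⟫) • (𝓕⁻ (a : V → ℂ) y * 𝓕⁻ (b : V → ℂ) (x - y))
      = VectorFourier.fourierIntegral Real.fourierChar volume (-innerₗ V) (a : V → ℂ) y • g y := by
    intro y
    have : 𝓕⁻ (a : V → ℂ) y = VectorFourier.fourierIntegral Real.fourierChar volume (-innerₗ V) (a : V → ℂ) y := rfl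
    rw [← this, hg]
    simp only [Circle.smul_def, smul_eq_mul]
    ring
  simp_rw [h2]
  rw [h1]
  congr 1
  ext ξ
  rw [smul_eq_mul]
  congr 1
  have h3 : VectorFourier.fourierIntegral Real.fourierChar volume (-innerₗ V).flip g ξ
      = ∫ y, Real.fourierChar ⟪x - (x - y), ξ - ζ⟫ • 𝓕⁻ (b : V → ℂ) (x - y) := by
    unfold VectorFourier.fourierIntegral
    congr 1
    ext y
    simp only [hg, smul_smul, ← AddChar.map_add_eq_mul]
    congr 2
    simp [inner_sub_right, real_inner_comm]
    ring
  rw [h3, integral_sub_left_eq_self (fun u => Real.fourierChar ⟪x - u, ξ - ζ⟫ • 𝓕⁻ (b : V → ℂ) u) volume x]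
  have h4 : ∀ u, Real.fourierChar ⟪x - u, ξ - ζ⟫ • 𝓕⁻ (b : V → ℂ) u =
     (Real.fourierChar ⟪x, ξ - ζ⟫ : ℂ) • (Real.fourierChar (-⟪u, ξ - ζ⟫) • 𝓕⁻ (b : V → ℂ) u) := by
    intro u
    rw [← Circle.smul_def, smul_smul, ← AddChar.map_add_eq_mul]
    congr 2
    rw [inner_sub_left]; ring
  simp_rw [h4]
  rw [integral_smul, ← Real.fourier_eq, Circle.smul_def]
  congr 1
  have := Continuous.fourier_fourierInv_eq b.continuous b.integrable
    (by rw [← SchwartzMap.fourier_coe]; exact (𝓕 b).integrable)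
  rw [this]

lemma fourierInv_mul_eq_integral (a b : SchwartzMap V ℂ) (x : V) :
    𝓕⁻ (fun ξ => a ξ * b ξ) x = ∫ y, 𝓕⁻ (a : V → ℂ) y * 𝓕⁻ (b : V → ℂ) (x - y) := by
  have := fourier_conv_aux a b x 0
  rw [Real.fourier_eq] at this
  simp only [inner_zero_right, neg_zero, AddChar.map_zero_eq_one, one_smul, sub_zero] at this
  rw [this, Real.fourierInv_eq]
  congr 1; ext ξ
  rw [real_inner_comm, Circle.smul_def, Circle.smul_def]
  simp only [smul_eq_mul]; ring

lemma nikolskii_aux {F : V → ℂ} (hc : Continuous F) (hi : Integrable F) (R : ℝ)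
    (hR : ∀ ζ, R < ‖ζ‖ → 𝓕 F ζ = 0) (z : V) :
    ‖F z‖ ≤ volume.real (Metric.closedBall (0 : V) R) * ∫ y, ‖F y‖ := by
  have hFc : Continuous (𝓕 F) :=
    VectorFourier.fourierIntegral_continuous Real.continuous_fourierChar continuous_inner hi
  have hcs : HasCompactSupport (𝓕 F) := by
    refine HasCompactSupport.intro (isCompact_closedBall (0 : V) R) fun ζ hζ => hR ζ ?_
    simpa using hζ
  have hFi : Integrable (𝓕 F) := hFc.integrable_of_hasCompactSupport hcs
  have hinv := congrFun (Continuous.fourierInv_fourier_eq hc hi hFi) z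
  rw [← hinv, Real.fourierInv_eq]
  refine (norm_integral_le_integral_norm _).trans ?_
  simp only [Circle.norm_smul]
  have hs : ∀ ζ, ζ ∉ Metric.closedBall (0 : V) R → ‖𝓕 F ζ‖ = 0 := by
    intro ζ hζ
    rw [hR ζ (by simpa using hζ), norm_zero]
  rw [← setIntegral_eq_integral_of_forall_compl_eq_zero hs]
  have hb : ∀ ζ ∈ Metric.closedBall (0 : V) R, ‖(‖𝓕 F ζ‖ : ℝ)‖ ≤ ∫ y, ‖F y‖ := by
    intro ζ _
    rw [norm_norm]
    exact VectorFourier.norm_fourierIntegral_le_integral_norm _ _ _ _ _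
  have := norm_setIntegral_le_of_norm_le_const (μ := volume) (s := Metric.closedBall (0 : V) R)
    (measure_closedBall_lt_top) hb
  rw [mul_comm]
  exact (Real.le_norm_self _).trans this

lemma lintegral_nik {α : Type*} [MeasurableSpace α] {μ : Measure α} {p : ℝ} (hp : 0 < p) (hp1 : p ≤ 1)
    (F : α → ℝ≥0∞) (A : ℝ≥0∞) (hI : ∫⁻ y, F y ∂μ ≠ ∞) (hA : A ≠ ∞)
    (h : ∀ z, F z ≤ A * ∫⁻ y, F y ∂μ) :
    (∫⁻ y, F y ∂μ) ^ p ≤ A ^ (1 - p) * ∫⁻ y, F y ^ p ∂μ := by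
  set I := ∫⁻ y, F y ∂μ with hIdef
  rcases eq_or_ne I 0 with h0 | h0
  · rw [h0, ENNReal.zero_rpow_of_pos hp]; exact zero_le
  have h1 : I ≤ (A * I) ^ (1 - p) * ∫⁻ y, F y ^ p ∂μ := by
    rw [← lintegral_const_mul' _ _ (ENNReal.rpow_ne_top_of_nonneg (by linarith) (ENNReal.mul_ne_top hA hI))]
    rw [hIdef]
    apply lintegral_mono
    intro y
    have hFy : F y ≠ ∞ := ((h y).trans_lt (ENNReal.mul_lt_top hA.lt_top hI.lt_top)).ne
    calc F y = F y ^ (1 - p) * F y ^ p := by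
          rcases eq_or_ne (F y) 0 with h00 | h00
          · rw [h00, ENNReal.zero_rpow_of_pos hp, mul_zero]
          rw [← ENNReal.rpow_add _ _ h00 hFy]; simp
      _ ≤ _ := by
          exact mul_le_mul' (ENNReal.rpow_le_rpow (h y) (by linarith)) le_rfl
  have h2 : I ^ (1 - p) * I ^ p = I := by
    rw [← ENNReal.rpow_add _ _ h0 hI]; simp
  have h3 : I ^ (1 - p) ≠ 0 := by
    intro hh
    rw [ENNReal.rpow_eq_zero_iff] at hh
    tauto
  have h4 : I ^ (1 - p) ≠ ∞ := ENNReal.rpow_ne_top_of_nonneg (by linarith) hI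
  rw [ENNReal.mul_rpow_of_nonneg _ _ (by linarith)] at h1
  rw [← ENNReal.mul_le_mul_iff_right h3 h4, h2]
  refine h1.trans (le_of_eq (by ring))

lemma conv_pointwise_le_one (a b : SchwartzMap V ℂ) (R : ℝ)
    (hR : ∀ ξ ζ, R < ‖ζ‖ → a ξ * b (ξ - ζ) = 0) {p : ℝ} (hp : 0 < p) (hp1 : p ≤ 1) (x : V) :
    ‖𝓕⁻ (fun ξ => a ξ * b ξ) x‖ₑ ^ p ≤ volume (Metric.closedBall (0 : V) R) ^ (1 - p) *
      ∫⁻ y, ‖𝓕⁻ (a : V → ℂ) y‖ₑ ^ p * ‖𝓕⁻ (b : V → ℂ) (x - y)‖ₑ ^ p := by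
  have ha : (𝓕⁻ (a : V → ℂ)) = ⇑(𝓕⁻ a : SchwartzMap V ℂ) := (SchwartzMap.fourierInv_coe a).symm
  have hb : (𝓕⁻ (b : V → ℂ)) = ⇑(𝓕⁻ b : SchwartzMap V ℂ) := (SchwartzMap.fourierInv_coe b).symm
  set F : V → ℂ := fun y => 𝓕⁻ (a : V → ℂ) y * 𝓕⁻ (b : V → ℂ) (x - y) with hF
  have hc : Continuous F := by
    rw [hF, ha, hb]
    have := (𝓕⁻ a).continuous
    have := (𝓕⁻ b).continuous
    fun_prop
  have hi : Integrable F := by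
    have h1 : Integrable (fun y => 𝓕⁻ (b : V → ℂ) (x - y)) := by
      rw [hb]; exact (𝓕⁻ b).integrable.comp_sub_left x
    obtain ⟨C, hC⟩ := (𝓕⁻ a).decay 0 0
    refine h1.bdd_mul (c := C) (by rw [ha]; exact (𝓕⁻ a).continuous.aestronglyMeasurable) (ae_of_all _ fun y => ?_)
    rw [ha]
    simpa using hC.2 y
  have hnik := nikolskii_aux hc hi R (by
    intro ζ hζ
    rw [hF, fourier_conv_aux]
    have : ∀ ξ, a ξ * (Real.fourierChar (inner ℝ x (ξ - ζ)) • b (ξ - ζ)) = 0 := by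
      intro ξ
      rw [mul_smul_comm, hR ξ ζ hζ, smul_zero]
    simp [this])
  have hI : ∫⁻ y, ‖F y‖ₑ ≠ ∞ := hi.2.ne
  have hv : volume (Metric.closedBall (0 : V) R) ≠ ∞ := measure_closedBall_lt_top.ne
  have hz : ∀ z, ‖F z‖ₑ ≤ volume (Metric.closedBall (0 : V) R) * ∫⁻ y, ‖F y‖ₑ := by
    intro z
    have := ENNReal.ofReal_le_ofReal (hnik z)
    rw [ENNReal.ofReal_mul measureReal_nonneg, ofReal_norm, ofReal_integral_norm_eq_lintegral_enorm hi,
      measureReal_def, ENNReal.ofReal_toReal hv] at this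
    exact this
  have := lintegral_nik hp hp1 (fun y => ‖F y‖ₑ) _ hI hv hz
  rw [fourierInv_mul_eq_integral]
  refine (ENNReal.rpow_le_rpow (enorm_integral_le_lintegral_enorm _) hp.le).trans (this.trans (le_of_eq ?_))
  congr 2
  ext y
  rw [hF]
  simp only [enorm_mul]
  rw [ENNReal.mul_rpow_of_nonneg _ _ hp.le]

lemma conv_pointwise_one_lt (a b : SchwartzMap V ℂ) {p : ℝ} (hp : 1 < p) (x : V) :
    ‖𝓕⁻ (fun ξ => a ξ * b ξ) x‖ₑ ^ p ≤ (∫⁻ y, ‖𝓕⁻ (b : V → ℂ) y‖ₑ) ^ (p - 1) *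
      ∫⁻ y, ‖𝓕⁻ (a : V → ℂ) y‖ₑ ^ p * ‖𝓕⁻ (b : V → ℂ) (x - y)‖ₑ := by
  have ha : Continuous (𝓕⁻ (a : V → ℂ)) := by
    rw [← SchwartzMap.fourierInv_coe a]; exact (𝓕⁻ a).continuous
  have hb : Continuous (𝓕⁻ (b : V → ℂ)) := by
    rw [← SchwartzMap.fourierInv_coe b]; exact (𝓕⁻ b).continuous
  rw [fourierInv_mul_eq_integral]
  set h := 𝓕⁻ (a : V → ℂ)
  set k := 𝓕⁻ (b : V → ℂ)
  have hp0 : 0 < p := by linarith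
  obtain ⟨q, hpq⟩ : ∃ q, p.HolderConjugate q := ⟨_, Real.HolderConjugate.conjExponent hp⟩
  have hq0 : 0 < q := hpq.symm.pos
  have hhm : Measurable (fun y => ‖h y‖ₑ) := ha.enorm.measurable
  have hkm : Measurable (fun y => ‖k (x - y)‖ₑ) :=
    (hb.comp (continuous_const.sub continuous_id)).enorm.measurable
  have H := ENNReal.lintegral_mul_le_Lp_mul_Lq (volume : Measure V) hpq
    (f := fun y => ‖h y‖ₑ * ‖k (x - y)‖ₑ ^ (1/p)) (g := fun y => ‖k (x - y)‖ₑ ^ (1/q))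
    (hhm.mul (hkm.pow_const _)).aemeasurable (hkm.pow_const _).aemeasurable
  have e1 : ∀ y, ((fun y => ‖h y‖ₑ * ‖k (x - y)‖ₑ ^ (1/p)) * (fun y => ‖k (x - y)‖ₑ ^ (1/q))) y
      = ‖h y * k (x - y)‖ₑ := by
    intro y
    simp only [Pi.mul_apply, enorm_mul]
    rw [mul_assoc, ← ENNReal.rpow_add_of_nonneg _ _ (by positivity) (by positivity)]
    have : 1/p + 1/q = 1 := by simpa using hpq.inv_add_inv_eq_one
    rw [this, ENNReal.rpow_one]
  have e2 : ∀ y, (‖h y‖ₑ * ‖k (x - y)‖ₑ ^ (1/p)) ^ p = ‖h y‖ₑ ^ p * ‖k (x - y)‖ₑ := by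
    intro y
    rw [ENNReal.mul_rpow_of_nonneg _ _ hp0.le, ← ENNReal.rpow_mul, one_div_mul_cancel hp0.ne', ENNReal.rpow_one]
  have e3 : ∀ y, (‖k (x - y)‖ₑ ^ (1/q)) ^ q = ‖k (x - y)‖ₑ := by
    intro y
    rw [← ENNReal.rpow_mul, one_div_mul_cancel hq0.ne', ENNReal.rpow_one]
  simp_rw [e1, e2, e3] at H
  rw [lintegral_sub_left_eq_self (fun y => ‖k y‖ₑ) x] at H
  refine (ENNReal.rpow_le_rpow ((enorm_integral_le_lintegral_enorm _).trans H) hp0.le).trans (le_of_eq ?_)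
  rw [ENNReal.mul_rpow_of_nonneg _ _ hp0.le, ← ENNReal.rpow_mul, ← ENNReal.rpow_mul,
    one_div_mul_cancel hp0.ne', ENNReal.rpow_one, mul_comm]
  congr 2
  rw [one_div_mul_eq_div]
  exact hpq.div_conj_eq_sub_one

end
end

open MeasureTheory FourierTransform
open scoped ENNReal NNReal

noncomputable section

/-- Integer vector as a Euclidean vector. -/
def kvec {d : ℕ} (k : Fin d → ℤ) : EuclideanSpace ℝ (Fin d) := WithLp.toLp 2 (fun i => (k i : ℝ))

@[simp] lemma kvec_apply {d : ℕ} (k : Fin d → ℤ) (i : Fin d) : kvec k i = k i := rfl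

/-- Unnormalized window. -/
def rhoW (η : ℝ → ℝ) {d : ℕ} (k : Fin d → ℤ) (ξ : EuclideanSpace ℝ (Fin d)) : ℝ :=
  ∏ i, η (2 * (ξ i - k i))

lemma unifWindow_eq (η : ℝ → ℝ) {d : ℕ} (k : Fin d → ℤ) (ξ : EuclideanSpace ℝ (Fin d)) :
    unifWindow η k ξ = rhoW η k ξ / ∑' l, rhoW η l ξ := rfl

section
variable {η : ℝ → ℝ} {d : ℕ}

lemma rhoW_nonneg (hη : IsBump η) (k : Fin d → ℤ) (ξ : EuclideanSpace ℝ (Fin d)) : 0 ≤ rhoW η k ξ :=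
  Finset.prod_nonneg fun i _ => (hη.2.1 _).1

lemma rhoW_supp (hη : IsBump η) {k : Fin d → ℤ} {ξ : EuclideanSpace ℝ (Fin d)} (h : rhoW η k ξ ≠ 0) (i : Fin d) :
    |ξ i - k i| < 1 := by
  by_contra hc
  apply h
  refine Finset.prod_eq_zero (Finset.mem_univ i) (hη.2.2.2 _ ?_)
  rw [abs_mul, abs_two]; linarith

lemma rhoW_contDiff (hη : IsBump η) (k : Fin d → ℤ) : ContDiff ℝ (⊤ : ℕ∞) (rhoW η k) := by
  unfold rhoW
  apply contDiff_prod
  intro i _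
  apply hη.1.comp
  fun_prop

lemma rhoW_box (hη : IsBump η) (ξ₀ ξ : EuclideanSpace ℝ (Fin d)) (hξ : ξ ∈ Metric.ball ξ₀ 1) (l : Fin d → ℤ)
    (hl : l ∉ Finset.Icc (fun i => ⌊ξ₀ i⌋ - 2) (fun i => ⌊ξ₀ i⌋ + 3)) : rhoW η l ξ = 0 := by
  by_contra h
  apply hl
  rw [Finset.mem_Icc]
  have key : ∀ i, |ξ₀ i - l i| < 2 := by
    intro i
    have h1 := rhoW_supp hη h i
    have h2 : |ξ i - ξ₀ i| < 1 := by
      have := PiLp.norm_apply_le (ξ - ξ₀) i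
      rw [Metric.mem_ball, dist_eq_norm] at hξ
      simpa using this.trans_lt hξ
    rw [abs_lt] at *
    constructor <;> linarith
  constructor <;> intro i <;> have h1 := abs_lt.1 (key i) <;> have h2 := Int.floor_le (ξ₀ i) <;>
    have h3 := Int.lt_floor_add_one (ξ₀ i)
  · have : ((⌊ξ₀ i⌋ - 2 : ℤ) : ℝ) < l i := by push_cast; linarith
    exact (Int.cast_lt.1 this).le
  · have : (l i : ℝ) < ((⌊ξ₀ i⌋ + 3 : ℤ) : ℝ) := by push_cast; linarith
    exact (Int.cast_lt.1 this).le

lemma rhoW_summable (hη : IsBump η) (ξ : EuclideanSpace ℝ (Fin d)) : Summable (fun l => rhoW η l ξ) :=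
  summable_of_ne_finset_zero (fun l hl => rhoW_box hη ξ ξ (Metric.mem_ball_self one_pos) l hl)

lemma den_contDiff (hη : IsBump η) : ContDiff ℝ (⊤ : ℕ∞) (fun ξ : EuclideanSpace ℝ (Fin d) => ∑' l, rhoW η l ξ) := by
  rw [contDiff_iff_contDiffAt]
  intro ξ₀
  have h1 : ContDiff ℝ (⊤ : ℕ∞) (fun ξ : EuclideanSpace ℝ (Fin d) =>
      ∑ l ∈ Finset.Icc (fun i => ⌊ξ₀ i⌋ - 2) (fun i => ⌊ξ₀ i⌋ + 3), rhoW η l ξ) :=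
    ContDiff.sum fun l _ => rhoW_contDiff hη l
  refine h1.contDiffAt.congr_of_eventuallyEq ?_
  filter_upwards [Metric.ball_mem_nhds ξ₀ one_pos] with ξ hξ
  exact tsum_eq_sum fun l hl => rhoW_box hη ξ₀ ξ hξ l hl

lemma one_le_den (hη : IsBump η) (ξ : EuclideanSpace ℝ (Fin d)) : 1 ≤ ∑' l, rhoW η l ξ := by
  have h1 : rhoW η (fun i => round (ξ i)) ξ = 1 := by
    unfold rhoW
    refine Finset.prod_eq_one fun i _ => hη.2.2.1 _ ?_
    rw [abs_mul, abs_two]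
    linarith [abs_sub_round (ξ i)]
  rw [← h1]
  exact (rhoW_summable hη ξ).le_tsum _ fun l _ => rhoW_nonneg hη l ξ

lemma window_nonneg (hη : IsBump η) (k : Fin d → ℤ) (ξ : EuclideanSpace ℝ (Fin d)) : 0 ≤ unifWindow η k ξ :=
  div_nonneg (rhoW_nonneg hη k ξ) (zero_le_one.trans (one_le_den hη ξ))

lemma window_hasSum (hη : IsBump η) (ξ : EuclideanSpace ℝ (Fin d)) : HasSum (fun k => unifWindow η k ξ) 1 := by
  have h := (rhoW_summable hη ξ).hasSum.div_const (∑' l, rhoW η l ξ)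
  rwa [div_self (by linarith [one_le_den hη ξ])] at h

lemma window_le_one (hη : IsBump η) (k : Fin d → ℤ) (ξ : EuclideanSpace ℝ (Fin d)) : unifWindow η k ξ ≤ 1 := 
  le_hasSum (window_hasSum hη ξ) k fun l _ => window_nonneg hη l ξ

lemma window_supp (hη : IsBump η) {k : Fin d → ℤ} {ξ : EuclideanSpace ℝ (Fin d)} (h : unifWindow η k ξ ≠ 0)
    (i : Fin d) : |ξ i - k i| < 1 := by
  refine rhoW_supp hη (fun h0 => h ?_) i
  rw [unifWindow_eq, h0, zero_div]

lemma window_contDiff (hη : IsBump η) (k : Fin d → ℤ) : ContDiff ℝ (⊤ : ℕ∞) (unifWindow η k : EuclideanSpace ℝ (Fin d) → ℝ) :=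
  (rhoW_contDiff hη k).div (den_contDiff hη) fun ξ => (zero_lt_one.trans_le (one_le_den hη ξ)).ne'

lemma norm_le_of_coord (z : EuclideanSpace ℝ (Fin d)) {B : ℝ} (hB : 0 ≤ B) (h : ∀ i, |z i| ≤ B) :
    ‖z‖ ≤ Real.sqrt (d * B ^ 2) := by
  rw [EuclideanSpace.norm_eq]
  apply Real.sqrt_le_sqrt
  calc ∑ i, ‖z i‖ ^ 2 ≤ ∑ i : Fin d, B ^ 2 := by
        gcongr with i
        exact h i
    _ = _ := by simp

lemma compactSupport_of_coord {F : Type*} [Zero F] (g : EuclideanSpace ℝ (Fin d) → F) (k : Fin d → ℤ) {B : ℝ} (hB : 0 ≤ B)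
    (h : ∀ ξ, g ξ ≠ 0 → ∀ i, |ξ i - k i| ≤ B) : HasCompactSupport g := by
  refine HasCompactSupport.intro (isCompact_closedBall (kvec k) (Real.sqrt (d * B ^ 2))) fun ξ hξ => ?_
  by_contra h0
  apply hξ
  rw [Metric.mem_closedBall, dist_eq_norm]
  apply norm_le_of_coord _ hB
  intro i
  simpa using h ξ h0 i

lemma window_translate (k : Fin d → ℤ) (ξ : EuclideanSpace ℝ (Fin d)) :
    unifWindow η k ξ = unifWindow η 0 (ξ - kvec k) := by
  rw [unifWindow_eq, unifWindow_eq]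
  have h1 : ∀ l : Fin d → ℤ, rhoW η l (ξ - kvec k) = rhoW η (l + k) ξ := by
    intro l
    unfold rhoW
    congr 1; ext i
    congr 2
    simp; ring
  simp_rw [h1]
  rw [zero_add]
  congr 1
  exact ((Equiv.addRight k).tsum_eq (fun l => rhoW η l ξ)).symm
end
end

open MeasureTheory FourierTransform
open scoped ENNReal NNReal

noncomputable section

lemma eLpNorm_conv_bound {V W : Type*} [MeasurableSpace V] [MeasurableSpace W] 
    {μ : Measure V} {ν : Measure W} [SFinite μ] [SFinite ν]
    {p : ℝ≥0∞} (hp : p ≠ 0) (hpt : p ≠ ∞) (G : W → ℂ) (h : V → ℂ) (w : W → V → ℝ≥0∞) (B D : ℝ≥0∞)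
    (hB : B ≠ ∞)
    (hh : Measurable h) (hw : Measurable (Function.uncurry w))
    (hD : ∀ y, ∫⁻ x, w x y ∂ν ≤ D)
    (H : ∀ x, ‖G x‖ₑ ^ p.toReal ≤ B * ∫⁻ y, ‖h y‖ₑ ^ p.toReal * w x y ∂μ) :
    eLpNorm G p ν ≤ (B * D) ^ (1 / p.toReal) * eLpNorm h p μ := by
  have hp0 : 0 < p.toReal := ENNReal.toReal_pos hp hpt
  rw [eLpNorm_eq_lintegral_rpow_enorm_toReal hp hpt, eLpNorm_eq_lintegral_rpow_enorm_toReal hp hpt,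
    ← ENNReal.mul_rpow_of_nonneg _ _ (by positivity)]
  apply ENNReal.rpow_le_rpow _ (by positivity)
  calc ∫⁻ x, ‖G x‖ₑ ^ p.toReal ∂ν ≤ ∫⁻ x, B * ∫⁻ y, ‖h y‖ₑ ^ p.toReal * w x y ∂μ ∂ν := lintegral_mono H
    _ = B * ∫⁻ x, ∫⁻ y, ‖h y‖ₑ ^ p.toReal * w x y ∂μ ∂ν := lintegral_const_mul' _ _ hB
    _ = B * ∫⁻ y, ∫⁻ x, ‖h y‖ₑ ^ p.toReal * w x y ∂ν ∂μ := by
        rw [lintegral_lintegral_swap]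
        apply Measurable.aemeasurable
        exact (((hh.comp measurable_snd).enorm).pow_const _).mul hw
    _ ≤ B * ∫⁻ y, D * ‖h y‖ₑ ^ p.toReal ∂μ := by
        gcongr with y
        have hwy : Measurable fun x => w x y := hw.comp (measurable_id.prodMk measurable_const)
        rw [lintegral_const_mul _ hwy, mul_comm]
        gcongr
        exact hD y
    _ = _ := by
        rw [lintegral_const_mul _ (hh.enorm.pow_const _), mul_assoc]

/-- Weighted bound on translates of a Schwartz function over a subspace. -/
lemma schwartz_slice_bound {V W : Type*} [NormedAddCommGroup V] [NormedSpace ℝ V]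
    [NormedAddCommGroup W] [NormedSpace ℝ W] [FiniteDimensional ℝ W] [MeasurableSpace W] [BorelSpace W]
    (μ : Measure W) [μ.IsAddHaarMeasure] (K : SchwartzMap V ℂ) (i : W → V) (π : V → W)
    (hπ : ∀ x y, ‖x - π y‖ ≤ ‖i x - y‖) {r : ℝ} (hr : 0 < r) :
    ∃ D : ℝ≥0∞, D ≠ ∞ ∧ ∀ y, ∫⁻ x, ‖K (i x - y)‖ₑ ^ r ∂μ ≤ D := by
  obtain ⟨N, hN⟩ : ∃ N : ℕ, (Module.finrank ℝ W : ℝ) < N * r := by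
    obtain ⟨N, hN⟩ := exists_nat_gt ((Module.finrank ℝ W : ℝ) / r)
    exact ⟨N, by rwa [div_lt_iff₀ hr] at hN⟩
  obtain ⟨C, hC0, hC⟩ : ∃ C : ℝ, 0 ≤ C ∧ ∀ z, ‖K z‖ ≤ C * (1 + ‖z‖) ^ (-(N:ℝ)) := by
    have := SchwartzMap.one_add_le_sup_seminorm_apply (𝕜 := ℝ) (m := (N, 0)) le_rfl le_rfl K
    simp only [norm_iteratedFDeriv_zero] at this
    refine ⟨2 ^ N * ((Finset.Iic (N, 0)).sup fun m => SchwartzMap.seminorm ℝ m.1 m.2) K, ?_, fun z => ?_⟩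
    rotate_left
    · rw [Real.rpow_neg (by positivity), ← div_eq_mul_inv, le_div_iff₀ (by positivity), mul_comm,
        Real.rpow_natCast]
      exact this z
    · exact le_trans (by positivity) (this 0)
  have hint := integrable_one_add_norm (μ := μ) hN
  refine ⟨ENNReal.ofReal (C ^ r) * ∫⁻ x, ‖(1 + ‖x‖) ^ (-(N * r))‖ₑ ∂μ,
    ENNReal.mul_ne_top ENNReal.ofReal_ne_top hint.2.ne, fun y => ?_⟩
  rw [← lintegral_const_mul' _ _ ENNReal.ofReal_ne_top,
    ← lintegral_sub_right_eq_self (fun x => ENNReal.ofReal (C ^ r) * ‖(1 + ‖x‖) ^ (-(N * r))‖ₑ) (π y)]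
  apply lintegral_mono
  intro x
  dsimp only
  have h1 : ‖K (i x - y)‖ ≤ C * (1 + ‖x - π y‖) ^ (-(N:ℝ)) := by
    refine (hC _).trans ?_
    gcongr ?_ * ?_
    apply Real.rpow_le_rpow_of_nonpos (by positivity) _ (by simp)
    linarith [hπ x y]
  have h2 : ‖K (i x - y)‖ ^ r ≤ C ^ r * (1 + ‖x - π y‖) ^ (-(N * r)) := by
    refine (Real.rpow_le_rpow (norm_nonneg _) h1 hr.le).trans (le_of_eq ?_)
    rw [Real.mul_rpow hC0 (by positivity), ← Real.rpow_mul (by positivity)]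
    congr 2; ring
  rw [← ofReal_norm, ENNReal.ofReal_rpow_of_nonneg (norm_nonneg _) hr.le,
    Real.enorm_of_nonneg (by positivity), ← ENNReal.ofReal_mul (by positivity)]
  exact ENNReal.ofReal_le_ofReal h2

/-- Main single block estimate. -/
lemma block_bound {V W : Type*} [NormedAddCommGroup V] [InnerProductSpace ℝ V] [FiniteDimensional ℝ V]
    [MeasurableSpace V] [BorelSpace V]
    [NormedAddCommGroup W] [InnerProductSpace ℝ W] [FiniteDimensional ℝ W] [MeasurableSpace W] [BorelSpace W]
    (K : SchwartzMap V ℂ) (i : W → V) (hi : Continuous i) (π : V → W)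
    (hπ : ∀ x y, ‖x - π y‖ ≤ ‖i x - y‖) (R : ℝ) {p : ℝ≥0∞} (hp : 0 < p) :
    ∃ C : ℝ≥0∞, C ≠ ∞ ∧ ∀ a b : SchwartzMap V ℂ,
      (∀ z, ‖𝓕⁻ (b : V → ℂ) z‖ₑ = ‖K z‖ₑ) →
      (∀ ξ ζ, R < ‖ζ‖ → a ξ * b (ξ - ζ) = 0) →
      eLpNorm (fun x => 𝓕⁻ (fun ξ => a ξ * b ξ) (i x)) p volume ≤
        C * eLpNorm (𝓕⁻ (a : V → ℂ)) p volume := by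
  have hKi : ∫⁻ y, ‖K y‖ₑ ≠ ∞ := K.integrable.2.ne
  have hac : ∀ a : SchwartzMap V ℂ, Continuous (𝓕⁻ (a : V → ℂ)) := by
    intro a
    rw [← SchwartzMap.fourierInv_coe a]; exact (𝓕⁻ a).continuous
  have hKm : Measurable (Function.uncurry fun (x : W) (y : V) => ‖K (i x - y)‖ₑ) := by
    apply Continuous.measurable
    have := K.continuous
    change Continuous fun q : W × V => ‖K (i q.1 - q.2)‖ₑ
    fun_prop
  rcases eq_or_ne p ∞ with rfl | hpt
  · refine ⟨∫⁻ y, ‖K y‖ₑ, hKi, fun a b hb _ => ?_⟩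
    rw [eLpNorm_exponent_top, eLpNorm_exponent_top, eLpNormEssSup]
    refine essSup_le_of_ae_le _ (ae_of_all _ fun x => ?_)
    dsimp only
    rw [fourierInv_mul_eq_integral]
    refine (enorm_integral_le_lintegral_enorm _).trans ?_
    have h1 : ∀ᵐ y, ‖𝓕⁻ (a : V → ℂ) y * 𝓕⁻ (b : V → ℂ) (i x - y)‖ₑ ≤
        eLpNormEssSup (𝓕⁻ (a : V → ℂ)) volume * ‖K (i x - y)‖ₑ := by
      filter_upwards [enorm_ae_le_eLpNormEssSup (𝓕⁻ (a : V → ℂ)) volume] with y hy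
      rw [enorm_mul, hb]
      gcongr
    refine (lintegral_mono_ae h1).trans ?_
    have hKx : Measurable fun y => ‖K (i x - y)‖ₑ := hKm.comp (measurable_const.prodMk measurable_id)
    rw [lintegral_const_mul _ hKx, lintegral_sub_left_eq_self (fun y => ‖K y‖ₑ) (i x), mul_comm]
  have hp0 : 0 < p.toReal := ENNReal.toReal_pos hp.ne' hpt
  rcases le_or_gt p.toReal 1 with h1 | h1
  · obtain ⟨D, hD, hDb⟩ := schwartz_slice_bound (volume : Measure W) K i π hπ hp0
    have hBt : volume (Metric.closedBall (0 : V) R) ^ (1 - p.toReal) ≠ ∞ :=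
      ENNReal.rpow_ne_top_of_nonneg (by linarith) measure_closedBall_lt_top.ne
    refine ⟨(volume (Metric.closedBall (0 : V) R) ^ (1 - p.toReal) * D) ^ (1 / p.toReal), ?_, fun a b hb hR => ?_⟩
    · exact ENNReal.rpow_ne_top_of_nonneg (by positivity) (ENNReal.mul_ne_top hBt hD)
    · refine eLpNorm_conv_bound hp.ne' hpt _ _ (fun x y => ‖K (i x - y)‖ₑ ^ p.toReal) _ _ hBt
        (hac a).measurable (hKm.pow_const _) hDb fun x => ?_
      have := conv_pointwise_le_one a b R hR hp0 h1 (i x)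
      simpa only [hb] using this
  · obtain ⟨D, hD, hDb⟩ := schwartz_slice_bound (volume : Measure W) K i π hπ one_pos
    have hBt : (∫⁻ y, ‖K y‖ₑ) ^ (p.toReal - 1) ≠ ∞ :=
      ENNReal.rpow_ne_top_of_nonneg (by linarith) hKi
    refine ⟨((∫⁻ y, ‖K y‖ₑ) ^ (p.toReal - 1) * D) ^ (1 / p.toReal), ?_, fun a b hb hR => ?_⟩
    · exact ENNReal.rpow_ne_top_of_nonneg (by positivity) (ENNReal.mul_ne_top hBt hD)
    · simp only [ENNReal.rpow_one] at hDb
      refine eLpNorm_conv_bound hp.ne' hpt _ _ (fun x y => ‖K (i x - y)‖ₑ) _ _ hBt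
        (hac a).measurable hKm hDb fun x => ?_
      have := conv_pointwise_one_lt a b h1 (i x)
      simpa only [hb] using this
end

open MeasureTheory FourierTransform
open scoped ENNReal NNReal

noncomputable section

/-- Embedding of the hyperplane. -/
def embL (m : ℕ) : EuclideanSpace ℝ (Fin m) →ₗ[ℝ] EuclideanSpace ℝ (Fin (m+1)) where
  toFun x := WithLp.toLp 2 (Fin.snoc (fun i => x i) 0)
  map_add' x y := by
    ext i
    refine Fin.lastCases ?_ (fun j => ?_) i <;> simp
  map_smul' c x := by
    ext i
    refine Fin.lastCases ?_ (fun j => ?_) i <;> simp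

/-- Projection onto the hyperplane. -/
def projL (m : ℕ) : EuclideanSpace ℝ (Fin (m+1)) →ₗ[ℝ] EuclideanSpace ℝ (Fin m) where
  toFun y := WithLp.toLp 2 (fun i => y i.castSucc)
  map_add' x y := rfl
  map_smul' c x := rfl

@[simp] lemma embL_castSucc {m : ℕ} (x : EuclideanSpace ℝ (Fin m)) (i : Fin m) :
    embL m x i.castSucc = x i := by simp [embL]
@[simp] lemma embL_last {m : ℕ} (x : EuclideanSpace ℝ (Fin m)) :
    embL m x (Fin.last m) = 0 := by simp [embL]
@[simp] lemma projL_apply {m : ℕ} (y : EuclideanSpace ℝ (Fin (m+1))) (i : Fin m) :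
    projL m y i = y i.castSucc := rfl

lemma traceFn_eq {m : ℕ} (f : EuclideanSpace ℝ (Fin (m+1)) → ℂ) (x : EuclideanSpace ℝ (Fin m)) :
    traceFn f x = f (embL m x) := rfl

lemma inner_embL {m : ℕ} (x : EuclideanSpace ℝ (Fin m)) (y : EuclideanSpace ℝ (Fin (m+1))) :
    inner ℝ (embL m x) y = inner ℝ x (projL m y) := by
  simp [PiLp.inner_apply, Fin.sum_univ_castSucc]

lemma norm_projL_le {m : ℕ} (y : EuclideanSpace ℝ (Fin (m+1))) : ‖projL m y‖ ≤ ‖y‖ := by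
  rw [EuclideanSpace.norm_eq, EuclideanSpace.norm_eq]
  apply Real.sqrt_le_sqrt
  rw [Fin.sum_univ_castSucc]
  simp only [projL_apply]
  linarith [sq_nonneg ‖y (Fin.last m)‖]

lemma projL_embL {m : ℕ} (x : EuclideanSpace ℝ (Fin m)) : projL m (embL m x) = x := by
  ext i; simp

lemma norm_sub_projL {m : ℕ} (x : EuclideanSpace ℝ (Fin m)) (y : EuclideanSpace ℝ (Fin (m+1))) :
    ‖x - projL m y‖ ≤ ‖embL m x - y‖ := by
  have := norm_projL_le (embL m x - y)
  rwa [map_sub, projL_embL] at this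

lemma norm_embL {m : ℕ} (x : EuclideanSpace ℝ (Fin m)) : ‖embL m x‖ = ‖x‖ := by
  rw [EuclideanSpace.norm_eq, EuclideanSpace.norm_eq, Fin.sum_univ_castSucc]
  simp

lemma embL_continuous (m : ℕ) : Continuous (embL m) := LinearMap.continuous_of_finiteDimensional _
lemma projL_continuous (m : ℕ) : Continuous (projL m) := LinearMap.continuous_of_finiteDimensional _

/-- The trace of a Schwartz function, as a Schwartz function. -/
def traceS {m : ℕ} (f : SchwartzMap (EuclideanSpace ℝ (Fin (m+1))) ℂ) :
    SchwartzMap (EuclideanSpace ℝ (Fin m)) ℂ :=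
  SchwartzMap.compCLMOfAntilipschitz ℝ (K := 1) (g := (LinearMap.toContinuousLinearMap (embL m)))
    (ContinuousLinearMap.hasTemperateGrowth _)
    (AddMonoidHomClass.antilipschitz_of_bound _ (fun x => by simp [norm_embL])) f

lemma traceS_apply {m : ℕ} (f : SchwartzMap (EuclideanSpace ℝ (Fin (m+1))) ℂ)
    (x : EuclideanSpace ℝ (Fin m)) : traceS f x = f (embL m x) := rfl

lemma traceS_coe {m : ℕ} (f : SchwartzMap (EuclideanSpace ℝ (Fin (m+1))) ℂ) :
    ⇑(traceS f) = traceFn (⇑f) := rfl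

section
variable {V : Type*} [NormedAddCommGroup V] [InnerProductSpace ℝ V] [FiniteDimensional ℝ V]
  [MeasurableSpace V] [BorelSpace V]

lemma integral_char_fourierInv (b : SchwartzMap V ℂ) (x θ : V) :
    ∫ y, Real.fourierChar (inner ℝ y θ) • 𝓕⁻ (b : V → ℂ) (x - y) =
      Real.fourierChar (inner ℝ x θ) • b θ := by
  have h3 : ∀ y, Real.fourierChar (inner ℝ y θ) • 𝓕⁻ (b : V → ℂ) (x - y)
      = Real.fourierChar (inner ℝ (x - (x - y)) θ) • 𝓕⁻ (b : V → ℂ) (x - y) := by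
    intro y; rw [sub_sub_cancel]
  simp_rw [h3]
  rw [integral_sub_left_eq_self (fun u => Real.fourierChar (inner ℝ (x - u) θ) • 𝓕⁻ (b : V → ℂ) u) volume x]
  have h4 : ∀ u, Real.fourierChar (inner ℝ (x - u) θ) • 𝓕⁻ (b : V → ℂ) u =
     (Real.fourierChar (inner ℝ x θ) : ℂ) • (Real.fourierChar (-(inner ℝ u θ)) • 𝓕⁻ (b : V → ℂ) u) := by
    intro u
    rw [← Circle.smul_def, smul_smul, ← AddChar.map_add_eq_mul]
    congr 2
    rw [inner_sub_left]; ring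
  simp_rw [h4]
  rw [integral_smul, ← Real.fourier_eq, Circle.smul_def]
  congr 1
  have := Continuous.fourier_fourierInv_eq b.continuous b.integrable
    (by rw [← SchwartzMap.fourier_coe]; exact (𝓕 b).integrable)
  rw [this]

lemma fourierInv_translate_enorm (g : V → ℂ) (κ z : V) :
    ‖𝓕⁻ (fun ξ => g (ξ - κ)) z‖ₑ = ‖𝓕⁻ g z‖ₑ := by
  rw [Real.fourierInv_eq, Real.fourierInv_eq,
    ← integral_add_right_eq_self (fun v => Real.fourierChar (inner ℝ v z) • g (v - κ)) κ]
  have : ∀ v, Real.fourierChar (inner ℝ (v + κ) z) • g (v + κ - κ)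
      = (Real.fourierChar (inner ℝ κ z) : ℂ) • (Real.fourierChar (inner ℝ v z) • g v) := by
    intro v
    rw [← Circle.smul_def, smul_smul, ← AddChar.map_add_eq_mul, add_sub_cancel_right, inner_add_left, add_comm]
  simp_rw [this]
  rw [integral_smul, enorm_smul, ← ofReal_norm (Real.fourierChar (inner ℝ κ z) : ℂ), Circle.norm_coe]
  simp
end

lemma trace_formula {m : ℕ} (f : SchwartzMap (EuclideanSpace ℝ (Fin (m+1))) ℂ)
    (u : SchwartzMap (EuclideanSpace ℝ (Fin m)) ℂ) (x : EuclideanSpace ℝ (Fin m)) :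
    𝓕⁻ (fun ξ => u ξ * 𝓕 (traceFn (⇑f)) ξ) x =
      𝓕⁻ (fun ξ => u (projL m ξ) * 𝓕 (⇑f) ξ) (embL m x) := by
  have e0 : (fun ξ => u ξ * 𝓕 (traceFn (⇑f)) ξ) = fun ξ => (𝓕 (traceS f)) ξ * u ξ := by
    ext ξ
    rw [mul_comm, SchwartzMap.fourier_coe, traceS_coe]
  rw [e0, fourierInv_mul_eq_integral]
  have e1 : 𝓕⁻ (⇑(𝓕 (traceS f) : SchwartzMap (EuclideanSpace ℝ (Fin m)) ℂ)) = traceS f := by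
    rw [← SchwartzMap.fourierInv_coe, FourierTransform.fourierInv_fourier_eq]
  have e2 : 𝓕⁻ (⇑(𝓕 f : SchwartzMap (EuclideanSpace ℝ (Fin (m+1))) ℂ)) = f := by
    rw [← SchwartzMap.fourierInv_coe, FourierTransform.fourierInv_fourier_eq]
  rw [e1]
  let L : EuclideanSpace ℝ (Fin (m+1)) →ₗ[ℝ] EuclideanSpace ℝ (Fin m) →ₗ[ℝ] ℝ :=
    -((innerₗ (EuclideanSpace ℝ (Fin (m+1)))).compl₂ (embL m))
  have hL : ∀ ξ y, L ξ y = - inner ℝ ξ (embL m y) := fun ξ y => rfl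
  have hLc : Continuous fun p : EuclideanSpace ℝ (Fin (m+1)) × EuclideanSpace ℝ (Fin m) => L p.1 p.2 := by
    simp only [hL]
    have := embL_continuous m
    fun_prop
  have hui : Integrable (fun y => 𝓕⁻ (u : EuclideanSpace ℝ (Fin m) → ℂ) (x - y)) := by
    rw [← SchwartzMap.fourierInv_coe]; exact (𝓕⁻ u).integrable.comp_sub_left x
  have h1 := VectorFourier.integral_fourierIntegral_smul_eq_flip (μ := volume) (ν := volume) (L := L)
    (f := ⇑(𝓕 f : SchwartzMap (EuclideanSpace ℝ (Fin (m+1))) ℂ)) (g := fun y => 𝓕⁻ (u : EuclideanSpace ℝ (Fin m) → ℂ) (x - y))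
    Real.continuous_fourierChar hLc (𝓕 f).integrable hui
  have e3 : ∀ y, VectorFourier.fourierIntegral Real.fourierChar volume L (⇑(𝓕 f : SchwartzMap (EuclideanSpace ℝ (Fin (m+1))) ℂ)) y = traceS f y := by
    intro y
    rw [traceS_apply, ← congrFun e2 (embL m y), Real.fourierInv_eq]
    unfold VectorFourier.fourierIntegral
    simp only [hL, neg_neg]
  have e4 : ∀ ξ, VectorFourier.fourierIntegral Real.fourierChar volume L.flip
      (fun y => 𝓕⁻ (u : EuclideanSpace ℝ (Fin m) → ℂ) (x - y)) ξ =
      Real.fourierChar (inner ℝ x (projL m ξ)) • u (projL m ξ) := by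
    intro ξ
    rw [← integral_char_fourierInv]
    unfold VectorFourier.fourierIntegral
    simp only [LinearMap.flip_apply, hL, neg_neg]
    congr 1; ext y
    rw [real_inner_comm, inner_embL]
  simp_rw [e3, e4, smul_eq_mul] at h1
  rw [h1, Real.fourierInv_eq]
  congr 1; ext ξ
  rw [real_inner_comm (embL m x) ξ, inner_embL, SchwartzMap.fourier_coe, Circle.smul_def, Circle.smul_def]
  simp only [smul_eq_mul]; ring

lemma jbr_pos {d : ℕ} (k : Fin d → ℤ) : 0 < jbr k := by
  unfold jbr
  have : 0 ≤ ∑ i, ((k i : ℝ))^2 := Finset.sum_nonneg fun i _ => sq_nonneg _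
  positivity

lemma jbr_le {d : ℕ} (k l : Fin d → ℤ) (h : ∀ i, |(k i : ℝ) - l i| ≤ 1) :
    jbr k ≤ (2 + 2 * d : ℝ) ^ ((1:ℝ)/2) * jbr l := by
  unfold jbr
  have h0 : ∀ k : Fin d → ℤ, 0 ≤ ∑ i, ((k i : ℝ))^2 := fun k => Finset.sum_nonneg fun i _ => sq_nonneg _
  have h1 : ∑ i, ((k i : ℝ))^2 ≤ 2 * ∑ i, ((l i : ℝ))^2 + 2 * d := by
    calc ∑ i, ((k i : ℝ))^2 ≤ ∑ i, (2 * (l i : ℝ)^2 + 2) := by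
          refine Finset.sum_le_sum fun i _ => ?_
          have := abs_le.1 (h i)
          nlinarith [sq_nonneg ((k i : ℝ) - 2 * l i)]
      _ = _ := by rw [Finset.sum_add_distrib, ← Finset.mul_sum]; simp; ring
  have := h0 l
  rw [← Real.mul_rpow (by positivity) (by positivity)]
  have := h0 k
  apply Real.rpow_le_rpow (by positivity) _ (by norm_num)
  have hd : (0:ℝ) ≤ d := Nat.cast_nonneg d
  nlinarith [h0 l]

lemma jbr_rpow_le {d : ℕ} (k l : Fin d → ℤ) (h : ∀ i, |(k i : ℝ) - l i| ≤ 1) (s : ℝ) :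
    jbr k ^ s ≤ ((2 + 2 * d : ℝ) ^ ((1:ℝ)/2)) ^ |s| * jbr l ^ s := by
  have hA : (0:ℝ) < (2 + 2 * d : ℝ) ^ ((1:ℝ)/2) := by positivity
  have hk := jbr_pos k
  have hl := jbr_pos l
  rcases le_or_gt 0 s with hs | hs
  · rw [abs_of_nonneg hs, ← Real.mul_rpow hA.le hl.le]
    exact Real.rpow_le_rpow hk.le (jbr_le k l h) hs
  · have h2 := jbr_le l k (fun i => by rw [abs_sub_comm]; exact h i)
    have h3 := Real.rpow_le_rpow_of_nonpos hl h2 hs.le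
    rw [Real.mul_rpow hA.le hk.le] at h3
    rw [abs_of_neg hs, Real.rpow_neg hA.le, ← div_eq_inv_mul, le_div_iff₀ (by positivity), mul_comm]
    exact h3
end

open MeasureTheory FourierTransform
open scoped ENNReal NNReal

noncomputable section

section
variable {η : ℝ → ℝ} {m : ℕ}

/-- The window as a Schwartz function. -/
lemma exists_windowS (hη : IsBump η) {d : ℕ} (k : Fin d → ℤ) : ∃ u : SchwartzMap (EuclideanSpace ℝ (Fin d)) ℂ,
    ∀ ξ, u ξ = (unifWindow η k ξ : ℂ) := by
  have hc : HasCompactSupport (fun ξ : EuclideanSpace ℝ (Fin d) => (unifWindow η k ξ : ℂ)) := by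
    refine compactSupport_of_coord _ k zero_le_one fun ξ h i => ?_
    exact (window_supp hη (by simpa using h) i).le
  exact ⟨hc.toSchwartzMap (Complex.ofRealCLM.contDiff.comp (window_contDiff hη k)), fun ξ => rfl⟩

/-- The localized Fourier transform as a Schwartz function. -/
lemma exists_blockS (hη : IsBump η) (l : Fin (m+1) → ℤ) (f : SchwartzMap (EuclideanSpace ℝ (Fin (m+1))) ℂ) :
    ∃ a : SchwartzMap (EuclideanSpace ℝ (Fin (m+1))) ℂ,
    ∀ ξ, a ξ = (unifWindow η l ξ : ℂ) * 𝓕 (⇑f) ξ := by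
  have hc : HasCompactSupport (fun ξ : EuclideanSpace ℝ (Fin (m+1)) =>
      (unifWindow η l ξ : ℂ) * (𝓕 f : SchwartzMap (EuclideanSpace ℝ (Fin (m+1))) ℂ) ξ) := by
    refine compactSupport_of_coord _ l zero_le_one fun ξ h i => ?_
    have := left_ne_zero_of_mul h
    exact (window_supp hη (by simpa using this) i).le
  refine ⟨hc.toSchwartzMap ((Complex.ofRealCLM.contDiff.comp (window_contDiff hη l)).mul
    ((𝓕 f : SchwartzMap (EuclideanSpace ℝ (Fin (m+1))) ℂ).smooth _)), fun ξ => rfl⟩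

/-- The multiplier. -/
def symb (η : ℝ → ℝ) {m : ℕ} (k : Fin m → ℤ) (t : ℤ) (ξ : EuclideanSpace ℝ (Fin (m+1))) : ℝ :=
  unifWindow η k (projL m ξ) * η (ξ (Fin.last m) - t)

lemma symb_supp (hη : IsBump η) {k : Fin m → ℤ} {t : ℤ} {ξ : EuclideanSpace ℝ (Fin (m+1))} (h : symb η k t ξ ≠ 0) :
    (∀ i : Fin m, |ξ i.castSucc - k i| < 1) ∧ |ξ (Fin.last m) - t| < 2 := by
  refine ⟨fun i => window_supp hη (left_ne_zero_of_mul h) i, ?_⟩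
  by_contra hc
  exact right_ne_zero_of_mul h (hη.2.2.2 _ (not_lt.1 hc))

lemma exists_symbS (hη : IsBump η) (k : Fin m → ℤ) (t : ℤ) : ∃ b : SchwartzMap (EuclideanSpace ℝ (Fin (m+1))) ℂ,
    ∀ ξ, b ξ = (symb η k t ξ : ℂ) := by
  have hc : HasCompactSupport (fun ξ : EuclideanSpace ℝ (Fin (m+1)) => (symb η k t ξ : ℂ)) := by
    refine compactSupport_of_coord _ (Fin.snoc k t) zero_le_two fun ξ h i => ?_
    obtain ⟨h1, h2⟩ := symb_supp hη (by simpa using h)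
    refine Fin.lastCases ?_ (fun j => ?_) i
    · simpa using h2.le
    · simpa using (h1 j).le.trans one_le_two
  have hs : ContDiff ℝ (⊤ : ℕ∞) (symb η k t : EuclideanSpace ℝ (Fin (m+1)) → ℝ) := by
    unfold symb
    refine ContDiff.mul ?_ ?_
    · exact (window_contDiff hη k).comp (LinearMap.toContinuousLinearMap (projL m)).contDiff
    · apply hη.1.comp
      fun_prop
  exact ⟨hc.toSchwartzMap (Complex.ofRealCLM.contDiff.comp hs), fun ξ => rfl⟩

lemma symb_translate (k : Fin m → ℤ) (t : ℤ) (ξ : EuclideanSpace ℝ (Fin (m+1))) :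
    symb η k t ξ = symb η 0 0 (ξ - kvec (Fin.snoc k t)) := by
  unfold symb
  rw [window_translate]
  congr 2
  · congr 1; ext i; simp
  · simp

lemma symb_mul_window (hη : IsBump η) (k : Fin m → ℤ) (l : Fin (m+1) → ℤ) (ξ : EuclideanSpace ℝ (Fin (m+1))) :
    unifWindow η l ξ * symb η k (l (Fin.last m)) ξ = unifWindow η k (projL m ξ) * unifWindow η l ξ := by
  by_cases h : unifWindow η l ξ = 0
  · simp [h]
  · have := window_supp hη h (Fin.last m)
    rw [symb, hη.2.2.1 _ this.le]; ring

/-- The single block `𝓕⁻(ψ_k(ξ̄) ψ_l(ξ) f̂(ξ))` on the hyperplane. -/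
def Gblock (η : ℝ → ℝ) {m : ℕ} (k : Fin m → ℤ) (l : Fin (m+1) → ℤ)
    (f : SchwartzMap (EuclideanSpace ℝ (Fin (m+1))) ℂ) (x : EuclideanSpace ℝ (Fin m)) : ℂ :=
  𝓕⁻ (fun ξ => ((unifWindow η l ξ : ℂ) * 𝓕 (⇑f) ξ) * (symb η k (l (Fin.last m)) ξ : ℂ)) (embL m x)

lemma Gblock_continuous (hη : IsBump η) (k : Fin m → ℤ) (l : Fin (m+1) → ℤ)
    (f : SchwartzMap (EuclideanSpace ℝ (Fin (m+1))) ℂ) : Continuous (Gblock η k l f) := by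
  obtain ⟨a, ha⟩ := exists_blockS hη l f
  obtain ⟨b, hb⟩ := exists_symbS hη k (l (Fin.last m))
  have hi : Integrable (fun ξ => a ξ * b ξ) := by
    obtain ⟨C, hC⟩ := a.decay 0 0
    refine b.integrable.bdd_mul (c := C) a.continuous.aestronglyMeasurable (ae_of_all _ fun y => ?_)
    simpa using hC.2 y
  have h1 : Continuous (𝓕⁻ (fun ξ => a ξ * b ξ)) := by
    refine VectorFourier.fourierIntegral_continuous Real.continuous_fourierChar ?_ hi
    simp only [LinearMap.neg_apply, innerₗ_apply_apply]; fun_prop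
  have h2 : Gblock η k l f = fun x => 𝓕⁻ (fun ξ => a ξ * b ξ) (embL m x) := by
    ext x; simp only [Gblock, ha, hb]
  rw [h2]
  exact h1.comp (embL_continuous m)

lemma Gblock_zero (hη : IsBump η) (k : Fin m → ℤ) (l : Fin m → ℤ) (t : ℤ) (h : l - k ∉ Finset.Icc (-1 : Fin m → ℤ) 1)
    (f : SchwartzMap (EuclideanSpace ℝ (Fin (m+1))) ℂ) (x : EuclideanSpace ℝ (Fin m)) :
    Gblock η k (Fin.snoc l t) f x = 0 := by
  have : ∀ ξ, ((unifWindow η (Fin.snoc l t) ξ : ℂ) * 𝓕 (⇑f) ξ) *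
      (symb η k ((Fin.snoc l t : Fin (m+1) → ℤ) (Fin.last m)) ξ : ℂ) = 0 := by
    intro ξ
    by_contra h0
    apply h
    have h1 : unifWindow η (Fin.snoc l t) ξ ≠ 0 := by
      simpa using left_ne_zero_of_mul (left_ne_zero_of_mul h0)
    have h2 : symb η k ((Fin.snoc l t : Fin (m+1) → ℤ) (Fin.last m)) ξ ≠ 0 := by
      simpa using right_ne_zero_of_mul h0
    have key : ∀ i, -1 ≤ l i - k i ∧ l i - k i ≤ 1 := by
      intro i
      have h3 := window_supp hη h1 i.castSucc
      have h4 := (symb_supp hη h2).1 i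
      rw [Fin.snoc_castSucc] at h3
      rw [abs_lt] at h3 h4
      have h5 : ((l i - k i : ℤ) : ℝ) < ((2 : ℤ) : ℝ) := by push_cast; linarith
      have h6 : (((-2 : ℤ)) : ℝ) < ((l i - k i : ℤ) : ℝ) := by push_cast; linarith
      have h5 := Int.cast_lt.1 h5
      have h6 := Int.cast_lt.1 h6
      omega
    rw [Finset.mem_Icc]
    exact ⟨fun i => (key i).1, fun i => (key i).2⟩
  unfold Gblock
  simp only [this]
  rw [Real.fourierInv_eq]; simp

lemma trace_decomp (hη : IsBump η) (k : Fin m → ℤ) (f : SchwartzMap (EuclideanSpace ℝ (Fin (m+1))) ℂ)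
    (x : EuclideanSpace ℝ (Fin m)) :
    ‖unifBox η k (traceFn (⇑f)) x‖ₑ ≤ ∑' l : Fin (m+1) → ℤ, ‖Gblock η k l f x‖ₑ := by
  obtain ⟨u, hu⟩ := exists_windowS hη k
  have e0 : unifBox η k (traceFn (⇑f)) x =
      𝓕⁻ (fun ξ => u (projL m ξ) * 𝓕 (⇑f) ξ) (embL m x) := by
    rw [← trace_formula]
    simp only [hu]; rfl
  set F : (Fin (m+1) → ℤ) → EuclideanSpace ℝ (Fin (m+1)) → ℂ := fun l ξ =>
    Real.fourierChar (inner ℝ ξ (embL m x)) •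
      (((unifWindow η l ξ : ℂ) * 𝓕 (⇑f) ξ) * (symb η k (l (Fin.last m)) ξ : ℂ)) with hF
  have hFs : ∀ l ξ, F l ξ = (unifWindow η l ξ : ℂ) *
      (Real.fourierChar (inner ℝ ξ (embL m x)) • (u (projL m ξ) * 𝓕 (⇑f) ξ)) := by
    intro l ξ
    have h1 : (unifWindow η l ξ : ℂ) * (symb η k (l (Fin.last m)) ξ : ℂ) =
        u (projL m ξ) * (unifWindow η l ξ : ℂ) := by
      rw [hu]; exact_mod_cast symb_mul_window hη k l ξ
    simp only [hF, Circle.smul_def, smul_eq_mul]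
    linear_combination (Real.fourierChar (inner ℝ ξ (embL m x)) : ℂ) * 𝓕 (⇑f) ξ * h1
  have hsum : ∀ ξ, ∑' l, F l ξ =
      Real.fourierChar (inner ℝ ξ (embL m x)) • (u (projL m ξ) * 𝓕 (⇑f) ξ) := by
    intro ξ
    simp_rw [hFs]
    rw [tsum_mul_right]
    have : ∑' l, (unifWindow η l ξ : ℂ) = 1 := by
      have := (Complex.hasSum_ofReal.2 (window_hasSum hη ξ)).tsum_eq
      simpa using this
    rw [this, one_mul]
  have hm : ∀ l, Continuous (F l) := by
    intro l
    obtain ⟨a, ha⟩ := exists_blockS hη l f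
    obtain ⟨b, hb⟩ := exists_symbS hη k (l (Fin.last m))
    simp only [hF, ← ha, ← hb, Circle.smul_def]
    have := a.continuous
    have := b.continuous
    have := Real.continuous_fourierChar
    fun_prop
  have hbound : ∀ ξ, ∑' l, ‖F l ξ‖ₑ ≤ ‖(𝓕 f : SchwartzMap (EuclideanSpace ℝ (Fin (m+1))) ℂ) ξ‖ₑ := by
    intro ξ
    have h1 : ∀ l, ‖F l ξ‖ₑ ≤ ENNReal.ofReal (unifWindow η l ξ) *
        ‖(𝓕 f : SchwartzMap (EuclideanSpace ℝ (Fin (m+1))) ℂ) ξ‖ₑ := by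
      intro l
      rw [hFs, ← ofReal_norm, ← ofReal_norm, ← ENNReal.ofReal_mul (window_nonneg hη l ξ)]
      apply ENNReal.ofReal_le_ofReal
      rw [norm_mul, Circle.norm_smul, norm_mul, hu, Complex.norm_real, Complex.norm_real,
        Real.norm_of_nonneg (window_nonneg hη _ _), Real.norm_of_nonneg (window_nonneg hη _ _)]
      apply mul_le_mul_of_nonneg_left _ (window_nonneg hη _ _)
      exact mul_le_of_le_one_left (norm_nonneg _) (window_le_one hη _ _)
    refine (ENNReal.tsum_le_tsum h1).trans ?_
    rw [ENNReal.tsum_mul_right, ← ENNReal.ofReal_tsum_of_nonneg (fun l => window_nonneg hη l ξ)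
      (window_hasSum hη ξ).summable, (window_hasSum hη ξ).tsum_eq]
    simp
  have hfin : ∑' l, ∫⁻ ξ, ‖F l ξ‖ₑ ≠ ∞ := by
    rw [← lintegral_tsum (fun l => (hm l).enorm.measurable.aemeasurable)]
    refine ((lintegral_mono hbound).trans_lt ?_).ne
    exact (𝓕 f : SchwartzMap (EuclideanSpace ℝ (Fin (m+1))) ℂ).integrable.2
  have := integral_tsum (fun l => (hm l).aestronglyMeasurable) hfin
  simp_rw [hsum] at this
  rw [e0, Real.fourierInv_eq, this]
  refine enorm_tsum_le_tsum_enorm.trans (le_of_eq ?_)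
  congr 1; ext l
  rw [Gblock, Real.fourierInv_eq]

lemma Gblock_bound (hη : IsBump η) {p : ℝ≥0∞} (hp : 0 < p) : ∃ C : ℝ≥0∞, C ≠ ∞ ∧
    ∀ (k j : Fin m → ℤ) (t : ℤ), j ∈ Finset.Icc (-1 : Fin m → ℤ) 1 →
    ∀ f : SchwartzMap (EuclideanSpace ℝ (Fin (m+1))) ℂ,
      eLpNorm (Gblock η k (Fin.snoc (k + j) t) f) p volume ≤
        C * eLpNorm (unifBox η (Fin.snoc (k + j) t) (⇑f)) p volume := by
  obtain ⟨σ, hσ⟩ := exists_symbS hη (0 : Fin m → ℤ) 0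
  obtain ⟨C, hC, H⟩ := block_bound (𝓕⁻ σ : SchwartzMap (EuclideanSpace ℝ (Fin (m+1))) ℂ) (embL m)
    (embL_continuous m) (projL m) norm_sub_projL (Real.sqrt ((m+1 : ℕ) * 3 ^ 2)) hp
  refine ⟨C, hC, fun k j t hj f => ?_⟩
  obtain ⟨a, ha⟩ := exists_blockS hη (Fin.snoc (k + j) t) f
  obtain ⟨b, hb⟩ := exists_symbS hη k t
  have := H a b ?_ ?_
  · have e1 : (fun x => 𝓕⁻ (fun ξ => a ξ * b ξ) (embL m x)) = Gblock η k (Fin.snoc (k + j) t) f := by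
      ext x; simp only [Gblock, ha, hb, Fin.snoc_last]
    have e2 : unifBox η (Fin.snoc (k + j) t) (⇑f) = 𝓕⁻ (⇑a) := by
      unfold unifBox; congr 1; ext ξ; rw [ha]
    rw [e1, ← e2] at this
    exact this
  · intro z
    have e3 : (⇑b) = fun ξ => σ (ξ - kvec (Fin.snoc k t)) := by
      ext ξ; rw [hb, hσ, symb_translate]
    rw [e3, fourierInv_translate_enorm, SchwartzMap.fourierInv_coe]
  · intro ξ ζ hζ
    by_contra h0
    apply not_le.2 hζ
    apply norm_le_of_coord _ (by norm_num)
    have h1 : unifWindow η (Fin.snoc (k + j) t) ξ ≠ 0 := by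
      have := left_ne_zero_of_mul h0
      rw [ha] at this
      simpa using left_ne_zero_of_mul this
    have h2 : symb η k t (ξ - ζ) ≠ 0 := by
      have := right_ne_zero_of_mul h0
      rw [hb] at this
      simpa using this
    have h3 := window_supp hη h1
    have h4 := symb_supp hη h2
    intro i
    refine Fin.lastCases ?_ (fun i => ?_) i
    · have h5 := h3 (Fin.last m)
      have h6 := h4.2
      rw [Fin.snoc_last] at h5
      simp only [PiLp.sub_apply] at h6
      rw [abs_lt] at h5 h6
      rw [abs_le]; constructor <;> linarith
    · have h5 := h3 i.castSucc
      have h6 := h4.1 i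
      rw [Fin.snoc_castSucc] at h5
      simp only [PiLp.sub_apply, Pi.add_apply, Int.cast_add] at h5 h6
      rw [Finset.mem_Icc] at hj
      have h7 : (-1 : ℝ) ≤ j i := by exact_mod_cast hj.1 i
      have h8 : (j i : ℝ) ≤ 1 := by exact_mod_cast hj.2 i
      rw [abs_lt] at h5 h6
      rw [abs_le]; constructor <;> linarith

end
/-- For `n = m+1 ≥ 2`, `0 < p, q ≤ ∞` and `s ∈ ℝ`, there is a constant
`C > 0` such that `‖Tr f‖_{M^s_{p,q}(ℝ^{n-1})} ≤ C ‖f‖_{M^s_{p,q,min(p,q,1)}(ℝⁿ)}`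
for every Schwartz function `f` on `ℝⁿ`. -/
theorem trace_modulation_bound
    (m : ℕ) (hm : 1 ≤ m) (η : ℝ → ℝ) (hη : IsBump η)
    (p q : ℝ≥0∞) (hp : 0 < p) (hq : 0 < q) (s : ℝ) :
    ∃ C : ℝ≥0∞, 0 < C ∧ C ≠ ∞ ∧
      ∀ f : SchwartzMap (EuclideanSpace ℝ (Fin (m+1))) ℂ,
        modNorm η s p q (traceFn (⇑f)) ≤
          C * modNormAniso η s p q (min p (min q 1)) (⇑f) := by
  set r : ℝ≥0∞ := min p (min q 1) with hrdef
  have hr : 0 < r := lt_min hp (lt_min hq one_pos)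
  have hrp : r ≤ p := min_le_left _ _
  have hrq : r ≤ q := (min_le_right _ _).trans (min_le_left _ _)
  have hr1 : r ≤ 1 := (min_le_right _ _).trans (min_le_right _ _)
  have hrt : r ≠ ∞ := (hr1.trans_lt ENNReal.one_lt_top).ne
  have hr0 : 0 < r.toReal := ENNReal.toReal_pos hr.ne' hrt
  obtain ⟨C₀, hC₀, H⟩ := Gblock_bound hη (m := m) hp
  set J : Finset (Fin m → ℤ) := Finset.Icc (-1) 1 with hJ
  set A : ℝ≥0∞ := ENNReal.ofReal (((2 + 2 * m : ℝ) ^ ((1:ℝ)/2)) ^ |s|) with hA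
  set C₁ : ℝ≥0∞ := (J.card : ℝ≥0∞) ^ (1 / r.toReal) * (A * C₀) with hC₁
  have hC₁t : C₁ ≠ ∞ := by
    refine ENNReal.mul_ne_top (ENNReal.rpow_ne_top_of_nonneg (by positivity) (ENNReal.natCast_ne_top _)) ?_
    exact ENNReal.mul_ne_top ENNReal.ofReal_ne_top hC₀
  refine ⟨C₁ + 1, by positivity, by simpa using hC₁t, fun f => ?_⟩
  refine le_trans ?_ (mul_le_mul' (le_self_add : C₁ ≤ C₁ + 1) le_rfl)
  unfold modNorm modNormAniso
  refine lqSum_bound hr hr1 hrq J (A * C₀) _ _ fun k => ?_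
  have h1 : eLpNorm (unifBox η k (traceFn (⇑f))) p volume ^ r.toReal ≤
      ∑' l : Fin (m+1) → ℤ, eLpNorm (Gblock η k l f) p volume ^ r.toReal := by
    have hmono := eLpNorm_mono_enorm (μ := volume) (p := p) (f := unifBox η k (traceFn (⇑f)))
      (g := fun x => ∑' l : Fin (m+1) → ℤ, ‖Gblock η k l f x‖ₑ)
      (fun x => by simpa using trace_decomp hη k f x)
    refine (ENNReal.rpow_le_rpow hmono hr0.le).trans ?_
    refine (eLpNorm_tsum_rpow_le volume hr hr1 hrp _
      (fun l => (Gblock_continuous hη k l f).enorm.measurable)).trans (le_of_eq ?_)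
    simp only [eLpNorm_enorm]
  have h2 : ∑' l : Fin (m+1) → ℤ, eLpNorm (Gblock η k l f) p volume ^ r.toReal =
      ∑' t : ℤ, ∑ j ∈ J, eLpNorm (Gblock η k (Fin.snoc (k + j) t) f) p volume ^ r.toReal := by
    rw [← (Fin.snocEquiv (fun _ : Fin (m+1) => ℤ)).tsum_eq, ENNReal.tsum_prod']
    congr 1; ext t
    rw [← (Equiv.addLeft k).tsum_eq]
    refine tsum_eq_sum fun j hj => ?_
    have : Gblock η k (Fin.snoc (k + j) t) f = 0 := by
      ext x
      exact Gblock_zero hη k (k + j) t (by rw [add_sub_cancel_left]; exact hj) f x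
    change eLpNorm (Gblock η k (Fin.snoc (k + j) t) f) p volume ^ r.toReal = 0
    rw [this, eLpNorm_zero, ENNReal.zero_rpow_of_pos hr0]
  rw [ENNReal.mul_rpow_of_nonneg _ _ hr0.le]
  refine (mul_le_mul' le_rfl (h1.trans h2.le)).trans ?_
  rw [← ENNReal.tsum_mul_left]
  refine ENNReal.tsum_le_tsum fun t => ?_
  rw [Finset.mul_sum]
  refine Finset.sum_le_sum fun j hj => ?_
  rw [← ENNReal.mul_rpow_of_nonneg _ _ hr0.le]
  refine ENNReal.rpow_le_rpow ?_ hr0.le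
  have h3 : ENNReal.ofReal (jbr k ^ s) ≤ A * ENNReal.ofReal (jbr (k + j) ^ s) := by
    rw [hA, ← ENNReal.ofReal_mul (by positivity)]
    refine ENNReal.ofReal_le_ofReal (jbr_rpow_le k (k + j) (fun i => ?_) s)
    rw [hJ, Finset.mem_Icc] at hj
    have h7 : (-1 : ℝ) ≤ j i := by exact_mod_cast hj.1 i
    have h8 : (j i : ℝ) ≤ 1 := by exact_mod_cast hj.2 i
    simp only [Pi.add_apply, Int.cast_add]
    rw [abs_le]; constructor <;> linarith
  refine (mul_le_mul' h3 (H k j t hj f)).trans (le_of_eq ?_)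
  ring
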